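/- Let U = {1, …, N}, S ⊆ U, x_i ∈ ℝ^p for i ∈ U and y_i ∈ ℝ for i ∈ S, and suppose the matrix A = ∑_{i∈S} x_i x_iᵀ is invertible. Define ω̂_i = (∑_{j=1}^N x_j)ᵀ A⁻¹ x_i for i ∈ S. Then: (a) the weights ω̂_i satisfy the calibration constraint ∑_{i∈S} ω̂_i x_i = ∑_{i=1}^N x_i; (b) (ω̂_i)_{i∈S} minimizes ∑_{i∈S} ω_i² over all weights satisfying this constraint, and is the unique such minimizer; and (c) the resulting estimator satisfies ∑_{i∈S} ω̂_i y_i = ∑_{i=1}^N x_iᵀβ̂, where β̂ = A⁻¹ ∑_{i∈S} x_i y_i is the least-squares coefficient. -/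

import Mathlib

open Finset Matrix

/-- Pairing weights with the linear scores `v ⬝ᵥ x i` amounts to pairing `v` with the
weighted total. -/
theorem sum_mul_dotProduct_eq_dotProduct_sum_smul {ι m R : Type*} [Fintype m] [CommSemiring R]
    (S : Finset ι) (x : ι → m → R) (v : m → R) (w : ι → R) :
    ∑ i ∈ S, w i * (v ⬝ᵥ x i) = v ⬝ᵥ ∑ i ∈ S, w i • x i := by
  simp [dotProduct_sum, dotProduct_smul]

theorem vecMul_sum_vecMulVec_self {ι m R : Type*} [Fintype m] [CommSemiring R]
    (S : Finset ι) (x : ι → m → R) (v : m → R) :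
    v ᵥ* (∑ i ∈ S, vecMulVec (x i) (x i)) = ∑ i ∈ S, (v ⬝ᵥ x i) • x i := by
  rw [vecMul_sum]
  simp [vecMul_vecMulVec]

/-- The squared-loss calibration weights
`ω̂ i = (∑ j, x j)ᵀ A⁻¹ x i` with `A = ∑_{i∈S} x i x iᵀ` invertible:
(a) they satisfy the calibration constraint `∑_{i∈S} ω̂ i • x i = ∑ j, x j`;
(b) they uniquely minimize `∑_{i∈S} ω i²` subject to the constraint;
(c) the resulting estimator equals the regression prediction estimator
`∑ j, x jᵀ β̂` with `β̂ = A⁻¹ ∑_{i∈S} y i • x i`. -/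
theorem stmt_12 (N p : ℕ) (S : Finset (Fin N))
    (x : Fin N → Fin p → ℝ) (y : Fin N → ℝ)
    (A : Matrix (Fin p) (Fin p) ℝ)
    (hA : A = ∑ i ∈ S, Matrix.vecMulVec (x i) (x i))
    (hAinv : IsUnit A.det)
    (ωhat : Fin N → ℝ)
    (hω : ∀ i, ωhat i = ((∑ j, x j) ᵥ* A⁻¹) ⬝ᵥ x i)
    (βhat : Fin p → ℝ)
    (hβ : βhat = A⁻¹ *ᵥ ∑ i ∈ S, y i • x i) :
    (∑ i ∈ S, ωhat i • x i = ∑ j, x j) ∧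
    (∀ w : Fin N → ℝ, ∑ i ∈ S, w i • x i = ∑ j, x j →
      ∑ i ∈ S, ωhat i ^ 2 ≤ ∑ i ∈ S, w i ^ 2) ∧
    (∀ w : Fin N → ℝ, ∑ i ∈ S, w i • x i = ∑ j, x j →
      ∑ i ∈ S, w i ^ 2 = ∑ i ∈ S, ωhat i ^ 2 → ∀ i ∈ S, w i = ωhat i) ∧
    (∑ i ∈ S, ωhat i * y i = ∑ j, x j ⬝ᵥ βhat) := by
  have hcal : ∑ i ∈ S, ωhat i • x i = ∑ j, x j := by
    simp_rw [hω]
    rw [← vecMul_sum_vecMulVec_self, ← hA, vecMul_vecMul, nonsing_inv_mul A hAinv, vecMul_one]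
  have hpair (w : Fin N → ℝ) :
      ∑ i ∈ S, w i * ωhat i = ((∑ j, x j) ᵥ* A⁻¹) ⬝ᵥ ∑ i ∈ S, w i • x i := by
    simp_rw [hω]
    exact sum_mul_dotProduct_eq_dotProduct_sum_smul S x _ w
  have hpyth (w : Fin N → ℝ) (hw : ∑ i ∈ S, w i • x i = ∑ j, x j) :
      ∑ i ∈ S, w i ^ 2 = ∑ i ∈ S, ωhat i ^ 2 + ∑ i ∈ S, (w i - ωhat i) ^ 2 := by
    have hcross : ∑ i ∈ S, w i * ωhat i = ∑ i ∈ S, ωhat i * ωhat i := by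
      rw [hpair, hpair, hw, hcal]
    have hexpand : ∑ i ∈ S, (w i ^ 2 - (ωhat i ^ 2 + (w i - ωhat i) ^ 2)) =
        2 * (∑ i ∈ S, w i * ωhat i - ∑ i ∈ S, ωhat i * ωhat i) := by
      rw [← sum_sub_distrib, mul_sum]
      exact sum_congr rfl fun i _ => by ring
    rw [sum_sub_distrib, sum_add_distrib, hcross] at hexpand
    linarith
  refine ⟨hcal, fun w hw => ?_, fun w hw heq i hi => ?_, ?_⟩
  · rw [hpyth w hw]
    exact le_add_of_nonneg_right (sum_nonneg fun i _ => sq_nonneg _)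
  · have hzero : ∑ i ∈ S, (w i - ωhat i) ^ 2 = 0 := by linarith [hpyth w hw]
    have hi0 := (sum_eq_zero_iff_of_nonneg fun i _ => sq_nonneg (w i - ωhat i)).1 hzero i hi
    exact sub_eq_zero.1 (pow_eq_zero_iff two_ne_zero |>.1 hi0)
  · simp_rw [mul_comm (ωhat _)]
    rw [← sum_dotProduct, hβ, dotProduct_mulVec]
    exact hpair y
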